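/- arXiv:2204.07039 — 5 statements merged into one kernel-verified Lean document; each statement's English description precedes it below -/
import Mathlib

section
/- Let N be a colored Petri net in which every color domain C(p) is finite and every binding set B(t)={b : G(t,b)=true} is finite, and let N^u be its unfolded P/T net. Then the initial marking M₀ of N and the initial marking M₀^u of N^u are bisimilar, where the LTS of N is labeled by ℓ(t)=t and the LTS of N^u is labeled by ℓ(t(b))=t for every unfolded transition t(b). -/
/- Formalization of colored Petri nets (CPN) following the paper's definitions. -/

noncomputable section
attribute [local instance] Classical.propDecidable
attribute [local instance] Classical.decEq

/-- A colored Petri net `N = (P,T,ℂ,𝔹,C,G,W,W_I,M₀)`: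
`dom` is the place color type function `C`, `guard` the guard evaluation `G`,
`pre`/`post` the arc evaluation `W` for place-to-transition and transition-to-place arcs,
`inhib` the inhibitor arc weight `W_I` (with `⊤` meaning no inhibitor arc),
and `M0` the initial marking. -/
structure CPN (P T C B : Type) where
  dom : P → Set C
  guard : T → B → Prop
  pre : P → T → B → Multiset C
  post : T → P → B → Multiset C
  inhib : P → T → ℕ∞
  M0 : P → Multiset C

variable {P T C B : Type}

/-- Well-formedness conditions from the definition of a CPN: color domains are nonempty,
arc expressions only use colors from the color domain of the connected place, inhibitor
weights are positive, and the initial marking is a marking. -/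
def CPN.WF (N : CPN P T C B) : Prop :=
  (∀ p, (N.dom p).Nonempty) ∧
  (∀ p t b, ∀ c ∈ N.pre p t b, c ∈ N.dom p) ∧
  (∀ p t b, ∀ c ∈ N.post t p b, c ∈ N.dom p) ∧
  (∀ p t, 0 < N.inhib p t) ∧
  (∀ p, ∀ c ∈ N.M0 p, c ∈ N.dom p)

/-- `M` is a marking of `N`: `set(M(p)) ⊆ C(p)` for all places `p`. -/
def CPN.IsMk (N : CPN P T C B) (M : P → Multiset C) : Prop :=
  ∀ p, ∀ c ∈ M p, c ∈ N.dom p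

/-- Transition firing `M →t M'`: there is a binding `b` satisfying the guard such that
`W((p,t),b) ⊆ M(p)` and `W_I(p,t) > |M(p)|` for all `p`, and
`M'(p) = (M(p) ∖ W((p,t),b)) ⊎ W((t,p),b)` for all `p`. -/
def CPN.Fires (N : CPN P T C B) (M : P → Multiset C) (t : T) (M' : P → Multiset C) : Prop :=
  ∃ b, N.guard t b ∧
    (∀ p, N.pre p t b ≤ M p) ∧
    (∀ p, ((M p).card : ℕ∞) < N.inhib p t) ∧
    (∀ p, M' p = M p - N.pre p t b + N.post t p b)

/-- Places of the unfolded P/T net: a place `p(c)` for each `p ∈ P` and `c ∈ C(p)`, and a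
summation place `p(sum)` for each place connected to an inhibitor arc. -/
def CPN.UPlace (N : CPN P T C B) : Type :=
  {pc : P × C // pc.2 ∈ N.dom pc.1} ⊕ {p : P // ∃ t, N.inhib p t ≠ ⊤}

/-- Pre-arc weights of the unfolded net: `W^u((p(c),t(b))) = W((p,t),b)(c)` and
`W^u((p(sum),t(b))) = |W((p,t),b)|`. -/
def CPN.upre (N : CPN P T C B) (t : T) (b : B) : N.UPlace → ℕ
  | Sum.inl ⟨(p, c), _⟩ => (N.pre p t b).count c
  | Sum.inr ⟨p, _⟩ => (N.pre p t b).card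

/-- Post-arc weights of the unfolded net: `W^u((t(b),p(c))) = W((t,p),b)(c)` and
`W^u((t(b),p(sum))) = |W((t,p),b)|`. -/
def CPN.upost (N : CPN P T C B) (t : T) (b : B) : N.UPlace → ℕ
  | Sum.inl ⟨(p, c), _⟩ => (N.post t p b).count c
  | Sum.inr ⟨p, _⟩ => (N.post t p b).card

/-- Inhibitor weights of the unfolded net: `W_I^u(p(sum),t(b)) = W_I(p,t)`, and `⊤` elsewhere. -/
def CPN.uinhib (N : CPN P T C B) (t : T) : N.UPlace → ℕ∞
  | Sum.inl _ => ⊤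
  | Sum.inr ⟨p, _⟩ => N.inhib p t

/-- Initial marking of the unfolded net: `M₀^u(p(c)) = M₀(p)(c)` and `M₀^u(p(sum)) = |M₀(p)|`. -/
def CPN.uM0 (N : CPN P T C B) : N.UPlace → ℕ
  | Sum.inl ⟨(p, c), _⟩ => (N.M0 p).count c
  | Sum.inr ⟨p, _⟩ => (N.M0 p).card

/-- The firing relation of the unfolded P/T net, labeled by `ℓ(t(b)) = t`: the unfolded
transition `t(b)` exists for every binding `b ∈ B(t)` (i.e. satisfying the guard). -/
def CPN.UStep (N : CPN P T C B) (M : N.UPlace → ℕ) (t : T) (M' : N.UPlace → ℕ) : Prop :=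
  ∃ b, N.guard t b ∧
    (∀ x, N.upre t b x ≤ M x) ∧
    (∀ x, (M x : ℕ∞) < N.uinhib t x) ∧
    (∀ x, M' x = M x - N.upre t b x + N.upost t b x)

/-- A bisimulation between two labeled transition systems (with a common label type `L`). -/
def IsBisim {S₁ S₂ L : Type} (st₁ : S₁ → L → S₁ → Prop) (st₂ : S₂ → L → S₂ → Prop)
    (R : S₁ → S₂ → Prop) : Prop :=
  (∀ s₁ s₂ a s₁', R s₁ s₂ → st₁ s₁ a s₁' → ∃ s₂', st₂ s₂ a s₂' ∧ R s₁' s₂') ∧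
  (∀ s₁ s₂ a s₂', R s₁ s₂ → st₂ s₂ a s₂' → ∃ s₁', st₁ s₁ a s₁' ∧ R s₁' s₂')

/-- Two states are bisimilar iff some bisimulation relates them. -/
def Bisimilar {S₁ S₂ L : Type} (st₁ : S₁ → L → S₁ → Prop) (st₂ : S₂ → L → S₂ → Prop)
    (s₁ : S₁) (s₂ : S₂) : Prop :=
  ∃ R, IsBisim st₁ st₂ R ∧ R s₁ s₂

/-- The unfolding of a family of multisets, whose components are the color counts and the
cardinalities. -/
def CPN.unfold (N : CPN P T C B) (M : P → Multiset C) : N.UPlace → ℕ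
  | Sum.inl ⟨(p, c), _⟩ => (M p).count c
  | Sum.inr ⟨p, _⟩ => (M p).card

lemma CPN.upre_eq_unfold (N : CPN P T C B) (t : T) (b : B) :
    N.upre t b = N.unfold (fun p => N.pre p t b) := by
  funext x
  rcases x with ⟨⟨p, c⟩, h⟩ | ⟨p, h⟩ <;> rfl

lemma CPN.upost_eq_unfold (N : CPN P T C B) (t : T) (b : B) :
    N.upost t b = N.unfold (fun p => N.post t p b) := by
  funext x
  rcases x with ⟨⟨p, c⟩, h⟩ | ⟨p, h⟩ <;> rfl

lemma CPN.uM0_eq_unfold (N : CPN P T C B) : N.uM0 = N.unfold N.M0 := by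
  funext x
  rcases x with ⟨⟨p, c⟩, h⟩ | ⟨p, h⟩ <;> rfl

lemma CPN.unfold_le_unfold_iff (N : CPN P T C B) {M M' : P → Multiset C} (hM : N.IsMk M) :
    (∀ x, N.unfold M x ≤ N.unfold M' x) ↔ ∀ p, M p ≤ M' p := by
  constructor
  · intro h p
    rw [Multiset.le_iff_count]
    intro c
    by_cases hc : c ∈ M p
    · exact h (Sum.inl ⟨(p, c), hM p c hc⟩)
    · simp [Multiset.count_eq_zero_of_notMem hc]
  · rintro h (⟨⟨p, c⟩, hc⟩ | ⟨p, hp⟩)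
    · exact Multiset.count_le_of_le c (h p)
    · exact Multiset.card_le_card (h p)

lemma CPN.unfold_lt_uinhib_iff (N : CPN P T C B) (M : P → Multiset C) (t : T) :
    (∀ x, (N.unfold M x : ℕ∞) < N.uinhib t x) ↔ ∀ p, ((M p).card : ℕ∞) < N.inhib p t := by
  constructor
  · intro h p
    by_cases hp : N.inhib p t = ⊤
    · rw [hp]
      exact ENat.natCast_lt_top _
    · exact h (Sum.inr ⟨p, t, hp⟩)
  · rintro h (⟨⟨p, c⟩, hc⟩ | ⟨p, hp⟩)
    · exact ENat.natCast_lt_top _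
    · exact h p

lemma CPN.unfold_sub_add (N : CPN P T C B) {M K L : P → Multiset C} (h : ∀ p, K p ≤ M p)
    (x : N.UPlace) :
    N.unfold (fun p => M p - K p + L p) x = N.unfold M x - N.unfold K x + N.unfold L x := by
  rcases x with ⟨⟨p, c⟩, hc⟩ | ⟨p, hp⟩
  · simp [CPN.unfold]
  · simp [CPN.unfold, Multiset.card_sub (h p)]

lemma CPN.Fires.uStep_unfold {N : CPN P T C B} (hWF : N.WF) {M M' : P → Multiset C} {t : T}
    (h : N.Fires M t M') : N.UStep (N.unfold M) t (N.unfold M') := by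
  obtain ⟨b, hb, hpre, hinh, hM'⟩ := h
  obtain rfl : M' = fun p => M p - N.pre p t b + N.post t p b := funext hM'
  refine ⟨b, hb, ?_, (N.unfold_lt_uinhib_iff M t).2 hinh, ?_⟩
  · rw [N.upre_eq_unfold]
    exact (N.unfold_le_unfold_iff fun p => hWF.2.1 p t b).2 hpre
  · rw [N.upre_eq_unfold, N.upost_eq_unfold]
    exact N.unfold_sub_add hpre

lemma CPN.UStep.exists_fires {N : CPN P T C B} (hWF : N.WF) {M : P → Multiset C} {t : T}
    {m : N.UPlace → ℕ} (h : N.UStep (N.unfold M) t m) :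
    ∃ M', N.Fires M t M' ∧ m = N.unfold M' := by
  obtain ⟨b, hb, hpre, hinh, hm⟩ := h
  rw [N.upre_eq_unfold] at hpre hm
  rw [N.upost_eq_unfold] at hm
  have hpre' := (N.unfold_le_unfold_iff fun p => hWF.2.1 p t b).1 hpre
  exact ⟨fun p => M p - N.pre p t b + N.post t p b,
    ⟨b, hb, hpre', (N.unfold_lt_uinhib_iff M t).1 hinh, fun _ => rfl⟩,
    funext fun x => (hm x).trans (N.unfold_sub_add hpre' x).symm⟩

/-- If every color domain and every satisfying-binding set of the CPN `N` is
finite, then the initial marking of `N` and the initial marking of the unfolded P/T net `N^u`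
are bisimilar (the LTS of `N` labeled by `ℓ(t) = t`, the LTS of `N^u` by `ℓ(t(b)) = t`). -/
theorem unfolded_net_bisimilar [Fintype P] [Fintype T] (N : CPN P T C B) (hWF : N.WF)
    (hdom : ∀ p, (N.dom p).Finite) (hbind : ∀ t, {b | N.guard t b}.Finite) :
    Bisimilar N.Fires N.UStep N.M0 N.uM0 := by
  refine ⟨fun M m => m = N.unfold M, ⟨?_, ?_⟩, N.uM0_eq_unfold⟩
  · rintro M _ t M' rfl h
    exact ⟨N.unfold M', h.uStep_unfold hWF, rfl⟩
  · rintro M _ t m rfl h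
    exact h.exists_fires hWF

end
end

section
/- In the proof of the quotienting theorem, the relation R = {(M,M^δ) : Σ_{c∈θ}M(p)(c) = M^δ(p)(θ) for all p∈P and all θ∈δ(p)}, relating markings M of a CPN N to markings M^δ of its quotient N^δ by a stable partition δ, is a bisimulation between the LTS of N and the LTS of N^δ (both labeled by transition names), and it contains the pair (M₀, M₀^δ) of initial markings. -/
/- Formalization of colored Petri nets (CPN) following the paper's definitions. -/

noncomputable section
attribute [local instance] Classical.propDecidable
attribute [local instance] Classical.decEq

variable {P T C B : Type}

/-- `Σ_{c∈θ} S(c)`: the number of elements of the multiset `S` whose color lies in `θ`. -/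
def countIn (S : Multiset C) (θ : Set C) : ℕ := (S.filter (· ∈ θ)).card

/-- `M ≡δ M'` iff for all `p ∈ P` and all `θ ∈ δ(p)`, `Σ_{c∈θ}M(p)(c) = Σ_{c∈θ}M'(p)(c)`. -/
def MarkEquiv (δ : P → Set (Set C)) (M M' : P → Multiset C) : Prop :=
  ∀ p, ∀ θ ∈ δ p, countIn (M p) θ = countIn (M' p) θ

/-- `δ` is a partition of `N`: for each place `p`, the equivalence classes in `δ(p)` are
nonempty, pairwise disjoint, and their union is `C(p)`. -/
def CPN.IsPartition (N : CPN P T C B) (δ : P → Set (Set C)) : Prop :=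
  ∀ p, ∅ ∉ δ p ∧ ⋃₀ δ p = N.dom p ∧
    ∀ θ₁ ∈ δ p, ∀ θ₂ ∈ δ p, θ₁ ≠ θ₂ → θ₁ ∩ θ₂ = ∅

/-- `δ` is stable: the relation `≡δ` on markings of `N` is a bisimulation on the LTS of `N`
labeled by transition names (stated for one direction; the other follows by symmetry of `≡δ`). -/
def CPN.IsStable (N : CPN P T C B) (δ : P → Set (Set C)) : Prop :=
  ∀ M₁ M₂, N.IsMk M₁ → N.IsMk M₂ → MarkEquiv δ M₁ M₂ →
    ∀ t M₁', N.Fires M₁ t M₁' → ∃ M₂', N.Fires M₂ t M₂' ∧ MarkEquiv δ M₁' M₂'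

/-- The equivalence class of the color `c` in the set of classes `D` (the unique `θ ∈ D`
containing `c`, when `D` is a partition and `c` is covered by `D`). -/
def classOf (D : Set (Set C)) (c : C) : Set C := ⋃₀ {θ ∈ D | c ∈ θ}

/-- The quotiented marking: `M^δ(p)(θ) = Σ_{c∈θ} M(p)(c)` for `θ ∈ δ(p)`. -/
def qMark (δ : P → Set (Set C)) (M : P → Multiset C) : P → Multiset (Set C) :=
  fun p => (M p).map (classOf (δ p))

/-- The firing relation of the quotiented CPN `N^δ`, labeled by transition names: `t` fires
under the binding class `[b]_t` of some `b ∈ B(t)`, with quotiented arc evaluations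
`W^δ((p,t),[b]_t)(θ) = Σ_{c∈θ}W((p,t),b)(c)` (and symmetrically for output arcs),
unchanged inhibitor weights, and the standard firing rule. -/
def CPN.QStep (N : CPN P T C B) (δ : P → Set (Set C))
    (M : P → Multiset (Set C)) (t : T) (M' : P → Multiset (Set C)) : Prop :=
  ∃ b, N.guard t b ∧
    (∀ p, (N.pre p t b).map (classOf (δ p)) ≤ M p) ∧
    (∀ p, ((M p).card : ℕ∞) < N.inhib p t) ∧
    (∀ p, M' p = M p - (N.pre p t b).map (classOf (δ p)) + (N.post t p b).map (classOf (δ p)))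

/-- The relation `R` from the proof of the quotienting theorem:
`(M, M^δ) ∈ R` iff `Σ_{c∈θ}M(p)(c) = M^δ(p)(θ)` for all `p ∈ P` and all `θ ∈ δ(p)`. -/
def QRel (δ : P → Set (Set C)) (M : P → Multiset C) (Mq : P → Multiset (Set C)) : Prop :=
  ∀ p, ∀ θ ∈ δ p, countIn (M p) θ = (Mq p).count θ

/-- `Mq` is a marking of the quotiented net `N^δ`: `set(Mq(p)) ⊆ C^δ(p) = δ(p)`. -/
def CPN.IsQMk (N : CPN P T C B) (δ : P → Set (Set C)) (Mq : P → Multiset (Set C)) : Prop :=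
  ∀ p, ∀ θ ∈ Mq p, θ ∈ δ p

theorem CPN.IsPartition.classOf_eq {N : CPN P T C B} {δ : P → Set (Set C)}
    (hδ : N.IsPartition δ) {p : P} {θ : Set C} (hθ : θ ∈ δ p) {c : C} (hc : c ∈ θ) :
    classOf (δ p) c = θ := by
  have h : {η ∈ δ p | c ∈ η} = {θ} := by
    ext η
    constructor
    · rintro ⟨hη, hcη⟩
      by_contra hne
      have hempty := (hδ p).2.2 η hη θ hθ hne
      exact (hempty ▸ (⟨hcη, hc⟩ : c ∈ η ∩ θ) : c ∈ (∅ : Set C))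
    · rintro rfl
      exact ⟨hθ, hc⟩
  rw [classOf, h, Set.sUnion_singleton]

theorem CPN.IsPartition.exists_mem {N : CPN P T C B} {δ : P → Set (Set C)}
    (hδ : N.IsPartition δ) {p : P} {c : C} (hc : c ∈ N.dom p) : ∃ θ ∈ δ p, c ∈ θ := by
  rwa [← (hδ p).2.1] at hc

theorem CPN.IsPartition.mem_dom {N : CPN P T C B} {δ : P → Set (Set C)}
    (hδ : N.IsPartition δ) {p : P} {θ : Set C} (hθ : θ ∈ δ p) {c : C} (hc : c ∈ θ) :
    c ∈ N.dom p := by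
  rw [← (hδ p).2.1]
  exact ⟨θ, hθ, hc⟩

theorem CPN.IsPartition.classOf_mem {N : CPN P T C B} {δ : P → Set (Set C)}
    (hδ : N.IsPartition δ) {p : P} {c : C} (hc : c ∈ N.dom p) : classOf (δ p) c ∈ δ p := by
  obtain ⟨θ, hθ, hcθ⟩ := hδ.exists_mem hc
  rwa [hδ.classOf_eq hθ hcθ]

theorem CPN.IsPartition.count_map_classOf {N : CPN P T C B} {δ : P → Set (Set C)}
    (hδ : N.IsPartition δ) {p : P} {S : Multiset C} (hS : ∀ c ∈ S, c ∈ N.dom p)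
    {θ : Set C} (hθ : θ ∈ δ p) : (S.map (classOf (δ p))).count θ = countIn S θ := by
  rw [Multiset.count_map, countIn]
  congr 1
  refine Multiset.filter_congr fun c hc => ⟨?_, fun h => (hδ.classOf_eq hθ h).symm⟩
  rintro rfl
  obtain ⟨η, hη, hcη⟩ := hδ.exists_mem (hS c hc)
  rwa [hδ.classOf_eq hη hcη]

theorem CPN.IsPartition.isQMk_qMark {N : CPN P T C B} {δ : P → Set (Set C)}
    (hδ : N.IsPartition δ) {M : P → Multiset C} (hM : N.IsMk M) : N.IsQMk δ (qMark δ M) := by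
  intro p θ hθ
  obtain ⟨c, hc, rfl⟩ := Multiset.mem_map.1 hθ
  exact hδ.classOf_mem (hM p c hc)

theorem CPN.IsPartition.qRel_qMark {N : CPN P T C B} {δ : P → Set (Set C)}
    (hδ : N.IsPartition δ) {M : P → Multiset C} (hM : N.IsMk M) : QRel δ M (qMark δ M) :=
  fun p _ hθ => (hδ.count_map_classOf (hM p) hθ).symm

theorem CPN.IsPartition.eq_qMark {N : CPN P T C B} {δ : P → Set (Set C)}
    (hδ : N.IsPartition δ) {M : P → Multiset C} {Mq : P → Multiset (Set C)} (hM : N.IsMk M)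
    (hMq : N.IsQMk δ Mq) (hR : QRel δ M Mq) : Mq = qMark δ M := by
  funext p
  ext θ
  by_cases hθ : θ ∈ δ p
  · rw [← hR p θ hθ, hδ.qRel_qMark hM p θ hθ]
  · rw [Multiset.count_eq_zero_of_notMem fun h => hθ (hMq p θ h),
      Multiset.count_eq_zero_of_notMem fun h => hθ (hδ.isQMk_qMark hM p θ h)]

theorem CPN.IsPartition.exists_map_classOf_eq {N : CPN P T C B} {δ : P → Set (Set C)}
    (hδ : N.IsPartition δ) {p : P} {S : Multiset (Set C)} (hS : ∀ θ ∈ S, θ ∈ δ p) :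
    ∃ X : Multiset C, (∀ c ∈ X, c ∈ N.dom p) ∧ X.map (classOf (δ p)) = S := by
  have hne : ∀ θ : δ p, ∃ c, c ∈ θ.1 := fun θ =>
    Set.nonempty_iff_ne_empty.2 fun h => (hδ p).1 (h ▸ θ.2)
  choose rep hrep using hne
  refine ⟨S.attach.map fun θ => rep ⟨θ.1, hS θ.1 θ.2⟩, fun c hc => ?_, ?_⟩
  · obtain ⟨θ, -, rfl⟩ := Multiset.mem_map.1 hc
    exact hδ.mem_dom (hS θ.1 θ.2) (hrep ⟨θ.1, hS θ.1 θ.2⟩)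
  · rw [Multiset.map_map]
    conv_rhs => rw [← Multiset.attach_map_val S]
    exact Multiset.map_congr rfl fun θ _ => hδ.classOf_eq (hS θ.1 θ.2) (hrep ⟨θ.1, hS θ.1 θ.2⟩)

theorem Multiset.map_sub_of_le {α β : Type*} [DecidableEq α] [DecidableEq β] (f : α → β)
    {s t : Multiset α} (h : t ≤ s) : (s - t).map f = s.map f - t.map f := by
  obtain ⟨u, rfl⟩ := Multiset.le_iff_exists_add.1 h
  simp

theorem CPN.WF.isMk_of_fires {N : CPN P T C B} (hN : N.WF) {M M' : P → Multiset C} {t : T}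
    (hM : N.IsMk M) (h : N.Fires M t M') : N.IsMk M' := by
  obtain ⟨b, -, -, -, hM'⟩ := h
  intro p c hc
  rw [hM' p, Multiset.mem_add] at hc
  exact hc.elim (fun h => hM p c (Multiset.mem_of_le (Multiset.sub_le_self _ _) h))
    (hN.2.2.1 p t b c)

theorem CPN.Fires.qStep_qMark {N : CPN P T C B} {M M' : P → Multiset C} {t : T}
    (h : N.Fires M t M') (δ : P → Set (Set C)) : N.QStep δ (qMark δ M) t (qMark δ M') := by
  obtain ⟨b, hb, hpre, hinh, hM'⟩ := h
  refine ⟨b, hb, fun p => Multiset.map_le_map (hpre p), fun p => ?_, fun p => ?_⟩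
  · simpa [qMark] using hinh p
  · simp only [qMark]
    rw [hM' p, Multiset.map_add, Multiset.map_sub_of_le _ (hpre p)]

/-- Every step of the quotient from `qMark δ M` is the image of a firing from some marking
with the same image as `M`. -/
theorem CPN.QStep.exists_fires {N : CPN P T C B} (hN : N.WF) {δ : P → Set (Set C)}
    (hδ : N.IsPartition δ) {M : P → Multiset C} {Mq' : P → Multiset (Set C)} {t : T}
    (hM : N.IsMk M) (h : N.QStep δ (qMark δ M) t Mq') :
    ∃ K K', N.IsMk K ∧ qMark δ K = qMark δ M ∧ N.Fires K t K' ∧ qMark δ K' = Mq' := by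
  obtain ⟨b, hb, hpre, hinh, hMq'⟩ := h
  have hrest : ∀ p, ∃ X : Multiset C, (∀ c ∈ X, c ∈ N.dom p) ∧
      X.map (classOf (δ p)) = qMark δ M p - (N.pre p t b).map (classOf (δ p)) := fun p =>
    hδ.exists_map_classOf_eq fun θ hθ =>
      hδ.isQMk_qMark hM p θ (Multiset.mem_of_le (Multiset.sub_le_self _ _) hθ)
  choose X hX hXmap using hrest
  have hK : qMark δ (fun p => N.pre p t b + X p) = qMark δ M := by
    funext p
    simp only [qMark, Multiset.map_add, hXmap]
    exact add_tsub_cancel_of_le (hpre p)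
  refine ⟨fun p => N.pre p t b + X p, fun p => X p + N.post t p b, fun p c hc => ?_, hK,
    ⟨b, hb, fun p => Multiset.le_add_right _ _, fun p => ?_, fun p => ?_⟩, ?_⟩
  · exact (Multiset.mem_add.1 hc).elim (hN.2.1 p t b c) (hX p c)
  · have hcard := congrArg Multiset.card (congrFun hK p)
    rw [qMark, Multiset.card_map] at hcard
    rw [hcard]
    exact hinh p
  · rw [add_tsub_cancel_left]
  · funext p
    rw [hMq' p, ← hXmap p, ← Multiset.map_add]
    rfl

/-- For a stable partition `δ` of the CPN `N`, the relation
`R = {(M,M^δ) : Σ_{c∈θ}M(p)(c) = M^δ(p)(θ) for all p, θ ∈ δ(p)}` is a bisimulation between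
the LTS of `N` and the LTS of the quotient `N^δ` (both labeled by transition names, with
states the markings of the respective nets), and it contains the pair of initial markings. -/
theorem quotient_relation_is_bisimulation [Fintype P] [Fintype T] (N : CPN P T C B)
    (hWF : N.WF) (δ : P → Set (Set C)) (hpart : N.IsPartition δ) (hstable : N.IsStable δ) :
    QRel δ N.M0 (qMark δ N.M0) ∧
    (∀ M Mq, N.IsMk M → N.IsQMk δ Mq → QRel δ M Mq →
      ∀ t M', N.Fires M t M' →
        ∃ Mq', N.IsQMk δ Mq' ∧ N.QStep δ Mq t Mq' ∧ QRel δ M' Mq') ∧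
    (∀ M Mq, N.IsMk M → N.IsQMk δ Mq → QRel δ M Mq →
      ∀ t Mq', N.QStep δ Mq t Mq' →
        ∃ M', N.IsMk M' ∧ N.Fires M t M' ∧ QRel δ M' Mq') := by
  refine ⟨hpart.qRel_qMark hWF.2.2.2.2, ?_, ?_⟩
  · intro M Mq hM hMq hR t M' hfire
    have hM' := hWF.isMk_of_fires hM hfire
    rw [hpart.eq_qMark hM hMq hR]
    exact ⟨qMark δ M', hpart.isQMk_qMark hM', hfire.qStep_qMark δ, hpart.qRel_qMark hM'⟩
  · intro M Mq hM hMq hR t Mq' hstep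
    obtain rfl := hpart.eq_qMark hM hMq hR
    obtain ⟨K, K', hK, hKM, hfire, rfl⟩ := hstep.exists_fires hWF hpart hM
    have hequiv : MarkEquiv δ K M := fun p θ hθ => by
      rw [hpart.qRel_qMark hK p θ hθ, hKM, hpart.qRel_qMark hM p θ hθ]
    obtain ⟨M', hfire', hequiv'⟩ := hstable K M hK hM hequiv t K' hfire
    refine ⟨M', hWF.isMk_of_fires hM hfire', hfire', fun p θ hθ => ?_⟩
    rw [← hequiv' p θ hθ]
    exact hpart.qRel_qMark (hWF.isMk_of_fires hK hfire) p θ hθ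

end
end

section
/- If δ₁ and δ₂ are stable partitions of a CPN N, then the partition union δ₁⊔δ₂ is also a stable partition of N. -/
/- Formalization of colored Petri nets (CPN) following the paper's definitions. -/

noncomputable section
attribute [local instance] Classical.propDecidable
attribute [local instance] Classical.decEq

variable {P T C B : Type}

/-- The relation `↔` on classes of `D`: `θ ↔ θ'` iff `θ,θ' ∈ D` and `θ ∩ θ' ≠ ∅`. -/
def linked (D : Set (Set C)) (θ θ' : Set C) : Prop :=
  θ ∈ D ∧ θ' ∈ D ∧ (θ ∩ θ').Nonempty

/-- `[θ] = ⋃ {θ' ∈ D : θ ↔* θ'}` where `↔*` is the reflexive-transitive closure of `↔`. -/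
def classUnion (D : Set (Set C)) (θ : Set C) : Set C :=
  ⋃₀ {θ' ∈ D | Relation.ReflTransGen (linked D) θ θ'}

/-- The partition union `δ₁ ⊔ δ₂`: `(δ₁ ⊔ δ₂)(p) = {[θ] : θ ∈ δ₁(p) ∪ δ₂(p)}`. -/
def partUnion (δ₁ δ₂ : P → Set (Set C)) : P → Set (Set C) :=
  fun p => classUnion (δ₁ p ∪ δ₂ p) '' (δ₁ p ∪ δ₂ p)

/-- Refinement order on partitions: `δ ≥ δ'` iff every class of `δ'(p)` is contained in some
class of `δ(p)`, for every place `p`. -/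
def PartGE (δ δ' : P → Set (Set C)) : Prop :=
  ∀ p, ∀ θ' ∈ δ' p, ∃ θ ∈ δ p, θ' ⊆ θ

/-- Strict refinement: `δ > δ'` iff `δ ≥ δ'` and `δ ≠ δ'`. -/
def PartGT (δ δ' : P → Set (Set C)) : Prop := PartGE δ δ' ∧ δ ≠ δ'

section Multisets

/-- Two colors are related when some class of `D` contains both. -/
def sameClass (D : Set (Set C)) (a b : C) : Prop := ∃ θ ∈ D, a ∈ θ ∧ b ∈ θ

theorem countIn_cons (a : C) (S : Multiset C) (θ : Set C) :
    countIn (a ::ₘ S) θ = (if a ∈ θ then 1 else 0) + countIn S θ := by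
  unfold countIn
  by_cases h : a ∈ θ <;> simp [h, add_comm]

theorem countIn_pos {S : Multiset C} {θ : Set C} : 0 < countIn S θ ↔ ∃ c ∈ S, c ∈ θ := by
  unfold countIn
  rw [Multiset.card_pos_iff_exists_mem]
  simp [Multiset.mem_filter]

/-- Multisets with the same number of elements in every class of a partition are matched
element by element within the classes. -/
theorem rel_sameClass_of_countIn_eq {D : Set (Set C)}
    (hdisj : ∀ θ₁ ∈ D, ∀ θ₂ ∈ D, θ₁ ≠ θ₂ → θ₁ ∩ θ₂ = ∅) {S S' : Multiset C}
    (hS : ∀ c ∈ S, c ∈ ⋃₀ D) (hS' : ∀ c ∈ S', c ∈ ⋃₀ D)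
    (h : ∀ θ ∈ D, countIn S θ = countIn S' θ) : Multiset.Rel (sameClass D) S S' := by
  induction S using Multiset.induction_on generalizing S' with
  | empty =>
    have : S' = 0 := by
      refine Multiset.eq_zero_of_forall_notMem fun c hc => ?_
      obtain ⟨θ, hθ, hcθ⟩ := hS' c hc
      have h0 := h θ hθ
      have := countIn_pos.2 ⟨c, hc, hcθ⟩
      rw [← h0] at this
      simp [countIn] at this
    rw [this]
    exact Multiset.Rel.zero
  | cons a S ih =>
    obtain ⟨θ, hθ, haθ⟩ := hS a (Multiset.mem_cons_self a S)
    have hpos : 0 < countIn S' θ := by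
      rw [← h θ hθ]
      exact countIn_pos.2 ⟨a, Multiset.mem_cons_self a S, haθ⟩
    obtain ⟨b, hb, hbθ⟩ := countIn_pos.1 hpos
    obtain ⟨S'', rfl⟩ := Multiset.exists_cons_of_mem hb
    refine Multiset.Rel.cons ⟨θ, hθ, haθ, hbθ⟩ (ih
      (fun c hc => hS c (Multiset.mem_cons_of_mem hc))
      (fun c hc => hS' c (Multiset.mem_cons_of_mem hc)) fun η hη => ?_)
    have hη' := h η hη
    have hab : a ∈ η ↔ b ∈ η := by
      by_cases e : θ = η
      · subst e; simp [haθ, hbθ]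
      · have hne := hdisj θ hθ η hη e
        exact ⟨fun ha => (Set.eq_empty_iff_forall_notMem.1 hne a ⟨haθ, ha⟩).elim,
          fun hb => (Set.eq_empty_iff_forall_notMem.1 hne b ⟨hbθ, hb⟩).elim⟩
    rw [countIn_cons, countIn_cons] at hη'
    simp only [hab] at hη'
    omega

theorem countIn_eq_of_rel {r : C → C → Prop} {K : Set C} (hr : ∀ a b, r a b → (a ∈ K ↔ b ∈ K))
    {S S' : Multiset C} (h : Multiset.Rel r S S') : countIn S K = countIn S' K := by
  induction h with
  | zero => rfl
  | cons hab _ ih => simp only [countIn_cons, hr _ _ hab, ih]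

end Multisets

section ClassUnion

theorem linked_symm {D : Set (Set C)} {θ η : Set C} (h : linked D θ η) : linked D η θ :=
  ⟨h.2.1, h.1, by rw [Set.inter_comm]; exact h.2.2⟩

theorem reflTransGen_linked_symm {D : Set (Set C)} {θ η : Set C}
    (h : Relation.ReflTransGen (linked D) θ η) : Relation.ReflTransGen (linked D) η θ := by
  induction h with
  | refl => exact .refl
  | tail _ hbc ih => exact .head (linked_symm hbc) ih

theorem subset_classUnion {D : Set (Set C)} {θ : Set C} (h : θ ∈ D) : θ ⊆ classUnion D θ :=
  fun _ hx => ⟨θ, ⟨h, .refl⟩, hx⟩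

theorem classUnion_congr {D : Set (Set C)} {θ η : Set C}
    (h : Relation.ReflTransGen (linked D) θ η) : classUnion D θ = classUnion D η := by
  ext x
  exact ⟨fun ⟨ζ, ⟨hζ, hl⟩, hx⟩ => ⟨ζ, ⟨hζ, (reflTransGen_linked_symm h).trans hl⟩, hx⟩,
    fun ⟨ζ, ⟨hζ, hl⟩, hx⟩ => ⟨ζ, ⟨hζ, h.trans hl⟩, hx⟩⟩

theorem mem_classUnion_of_sameClass {D : Set (Set C)} {θ : Set C} {a b : C}
    (hab : sameClass D a b) (ha : a ∈ classUnion D θ) : b ∈ classUnion D θ := by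
  obtain ⟨η, hη, haη, hbη⟩ := hab
  obtain ⟨ζ, ⟨hζ, hl⟩, haζ⟩ := ha
  exact ⟨η, ⟨hη, hl.tail ⟨hζ, hη, a, haζ, haη⟩⟩, hbη⟩

theorem sameClass_symm {D : Set (Set C)} {a b : C} (h : sameClass D a b) : sameClass D b a :=
  let ⟨θ, hθ, ha, hb⟩ := h
  ⟨θ, hθ, hb, ha⟩

theorem reflTransGen_sameClass_of_linked {D : Set (Set C)} {θ η : Set C} (hθ : θ ∈ D)
    (h : Relation.ReflTransGen (linked D) θ η) {a b : C} (ha : a ∈ θ) (hb : b ∈ η) :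
    Relation.ReflTransGen (sameClass D) a b := by
  induction h generalizing b with
  | refl => exact .single ⟨θ, hθ, ha, hb⟩
  | tail _ hl ih =>
    obtain ⟨_, hη, x, hx, hx'⟩ := hl
    exact (ih hx).tail ⟨_, hη, hx', hb⟩

theorem reflTransGen_sameClass_of_mem_classUnion {D : Set (Set C)} {θ : Set C} {a b : C}
    (ha : a ∈ classUnion D θ) (hb : b ∈ classUnion D θ) :
    Relation.ReflTransGen (sameClass D) a b := by
  obtain ⟨ζ, ⟨hζ, hl⟩, haζ⟩ := ha
  obtain ⟨η, ⟨_, hl'⟩, hbη⟩ := hb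
  exact reflTransGen_sameClass_of_linked hζ ((reflTransGen_linked_symm hl).trans hl') haζ hbη

end ClassUnion

theorem CPN.IsPartition.partUnion {N : CPN P T C B} {δ₁ δ₂ : P → Set (Set C)}
    (h₁ : N.IsPartition δ₁) (h₂ : N.IsPartition δ₂) : N.IsPartition (partUnion δ₁ δ₂) := by
  intro p
  obtain ⟨he₁, hu₁, -⟩ := h₁ p
  obtain ⟨he₂, hu₂, -⟩ := h₂ p
  have hu : ⋃₀ (δ₁ p ∪ δ₂ p) = N.dom p := by rw [Set.sUnion_union, hu₁, hu₂, Set.union_self]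
  refine ⟨?_, ?_, ?_⟩
  · rintro ⟨θ, hθ, h0⟩
    have : θ = ∅ := Set.subset_empty_iff.1 (h0 ▸ subset_classUnion hθ)
    subst this
    exact hθ.elim he₁ he₂
  · rw [← hu]
    ext x
    constructor
    · rintro ⟨_, ⟨θ, _, rfl⟩, η, ⟨hη, _⟩, hx⟩
      exact ⟨η, hη, hx⟩
    · rintro ⟨θ, hθ, hx⟩
      exact ⟨_, ⟨θ, hθ, rfl⟩, subset_classUnion hθ hx⟩
  · rintro _ ⟨θ, _, rfl⟩ _ ⟨η, _, rfl⟩ hne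
    by_contra hcon
    obtain ⟨x, ⟨ζ, ⟨hζ, hl⟩, hx⟩, ξ, ⟨hξ, hl'⟩, hx'⟩ := Set.nonempty_iff_ne_empty.2 hcon
    exact hne (classUnion_congr
      ((hl.tail ⟨hζ, hξ, x, hx, hx'⟩).trans (reflTransGen_linked_symm hl')))

theorem CPN.IsPartition.rel_sameClass {N : CPN P T C B} {δ : P → Set (Set C)}
    (h : N.IsPartition δ) {M M' : P → Multiset C} (hM : N.IsMk M) (hM' : N.IsMk M')
    (he : MarkEquiv δ M M') (p : P) : Multiset.Rel (sameClass (δ p)) (M p) (M' p) :=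
  rel_sameClass_of_countIn_eq (h p).2.2 ((h p).2.1 ▸ hM p) ((h p).2.1 ▸ hM' p) (he p)

theorem CPN.IsPartition.markEquiv_partUnion {N : CPN P T C B} {δ δ₁ δ₂ : P → Set (Set C)}
    (h : N.IsPartition δ) (hδ : ∀ p, δ p ⊆ δ₁ p ∪ δ₂ p) {M M' : P → Multiset C}
    (hM : N.IsMk M) (hM' : N.IsMk M') (he : MarkEquiv δ M M') :
    MarkEquiv (_root_.partUnion δ₁ δ₂) M M' := by
  rintro p _ ⟨θ, _, rfl⟩
  refine countIn_eq_of_rel (fun a b hab => ?_) (h.rel_sameClass hM hM' he p)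
  have hab' : sameClass (δ₁ p ∪ δ₂ p) a b :=
    let ⟨η, hη, hs⟩ := hab
    ⟨η, hδ p hη, hs⟩
  exact ⟨mem_classUnion_of_sameClass hab', mem_classUnion_of_sameClass (sameClass_symm hab')⟩

theorem CPN.IsMk.of_fires {N : CPN P T C B} (hWF : N.WF) {M M' : P → Multiset C} {t : T}
    (hM : N.IsMk M) (h : N.Fires M t M') : N.IsMk M' := by
  obtain ⟨b, -, -, -, hb⟩ := h
  intro p c hc
  rw [hb p, Multiset.mem_add] at hc
  exact hc.elim (fun h => hM p c (Multiset.mem_of_le tsub_le_self h)) (hWF.2.2.1 p t b c)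

/-- Markings of `N` that are equivalent for one of two partitions. -/
def CPN.MarkStep (N : CPN P T C B) (δ₁ δ₂ : P → Set (Set C)) (M M' : P → Multiset C) : Prop :=
  N.IsMk M ∧ N.IsMk M' ∧ (MarkEquiv δ₁ M M' ∨ MarkEquiv δ₂ M M')

/-- The contents of a single place, equivalent for one of two sets of classes. -/
def placeStep (A : Set C) (D₁ D₂ : Set (Set C)) (S S' : Multiset C) : Prop :=
  (∀ c ∈ S, c ∈ A) ∧ (∀ c ∈ S', c ∈ A) ∧
    ((∀ θ ∈ D₁, countIn S θ = countIn S' θ) ∨ ∀ θ ∈ D₂, countIn S θ = countIn S' θ)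

theorem placeStep.cons {A : Set C} {D₁ D₂ : Set (Set C)} {S S' : Multiset C} {a : C} (ha : a ∈ A)
    (h : placeStep A D₁ D₂ S S') : placeStep A D₁ D₂ (a ::ₘ S) (a ::ₘ S') := by
  obtain ⟨hS, hS', h⟩ := h
  refine ⟨Multiset.forall_mem_cons.2 ⟨ha, hS⟩, Multiset.forall_mem_cons.2 ⟨ha, hS'⟩,
    h.imp (fun h θ hθ => ?_) fun h θ hθ => ?_⟩ <;> rw [countIn_cons, countIn_cons, h θ hθ]

theorem placeStep_cons_of_sameClass {A : Set C} {D₁ D₂ : Set (Set C)}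
    (hu : ⋃₀ (D₁ ∪ D₂) ⊆ A)
    (hd₁ : ∀ θ₁ ∈ D₁, ∀ θ₂ ∈ D₁, θ₁ ≠ θ₂ → θ₁ ∩ θ₂ = ∅)
    (hd₂ : ∀ θ₁ ∈ D₂, ∀ θ₂ ∈ D₂, θ₁ ≠ θ₂ → θ₁ ∩ θ₂ = ∅) {S : Multiset C}
    (hS : ∀ c ∈ S, c ∈ A) {a b : C} (hab : sameClass (D₁ ∪ D₂) a b) :
    placeStep A D₁ D₂ (a ::ₘ S) (b ::ₘ S) := by
  obtain ⟨θ, hθ, ha, hb⟩ := hab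
  have key : ∀ D : Set (Set C), (∀ θ₁ ∈ D, ∀ θ₂ ∈ D, θ₁ ≠ θ₂ → θ₁ ∩ θ₂ = ∅) → θ ∈ D →
      ∀ η ∈ D, countIn (a ::ₘ S) η = countIn (b ::ₘ S) η := by
    intro D hD hθ η hη
    have hiff : a ∈ η ↔ b ∈ η := by
      by_cases e : θ = η
      · subst e; simp [ha, hb]
      · have hne := Set.eq_empty_iff_forall_notMem.1 (hD θ hθ η hη e)
        exact ⟨fun h => (hne a ⟨ha, h⟩).elim, fun h => (hne b ⟨hb, h⟩).elim⟩
    simp only [countIn_cons, hiff]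
  exact ⟨Multiset.forall_mem_cons.2 ⟨hu ⟨θ, hθ, ha⟩, hS⟩,
    Multiset.forall_mem_cons.2 ⟨hu ⟨θ, hθ, hb⟩, hS⟩, hθ.imp (key D₁ hd₁) (key D₂ hd₂)⟩

theorem reflTransGen_placeStep_of_rel {A : Set C} {D₁ D₂ : Set (Set C)}
    (hu : ⋃₀ (D₁ ∪ D₂) ⊆ A)
    (hd₁ : ∀ θ₁ ∈ D₁, ∀ θ₂ ∈ D₁, θ₁ ≠ θ₂ → θ₁ ∩ θ₂ = ∅)
    (hd₂ : ∀ θ₁ ∈ D₂, ∀ θ₂ ∈ D₂, θ₁ ≠ θ₂ → θ₁ ∩ θ₂ = ∅) {S S' : Multiset C}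
    (h : Multiset.Rel (Relation.ReflTransGen (sameClass (D₁ ∪ D₂))) S S')
    (hS : ∀ c ∈ S, c ∈ A) (hS' : ∀ c ∈ S', c ∈ A) :
    Relation.ReflTransGen (placeStep A D₁ D₂) S S' := by
  induction h with
  | zero => exact .refl
  | @cons a b S S' hab _ ih =>
    obtain ⟨ha, hS⟩ := Multiset.forall_mem_cons.1 hS
    obtain ⟨-, hS'⟩ := Multiset.forall_mem_cons.1 hS'
    exact ((ih hS hS').lift (a ::ₘ ·) fun _ _ => placeStep.cons ha).trans
      (hab.lift (· ::ₘ S') fun _ _ => placeStep_cons_of_sameClass hu hd₁ hd₂ hS')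

theorem CPN.MarkStep.update {N : CPN P T C B} {δ₁ δ₂ : P → Set (Set C)} {M : P → Multiset C}
    (hM : N.IsMk M) {p : P} {S S' : Multiset C} (h : placeStep (N.dom p) (δ₁ p) (δ₂ p) S S') :
    N.MarkStep δ₁ δ₂ (Function.update M p S) (Function.update M p S') := by
  obtain ⟨hS, hS', h⟩ := h
  have hmk : ∀ R : Multiset C, (∀ c ∈ R, c ∈ N.dom p) → N.IsMk (Function.update M p R) := by
    intro R hR q
    by_cases e : q = p
    · subst e; simpa using hR
    · simpa [e] using hM q
  have heq : ∀ δ : P → Set (Set C), (∀ θ ∈ δ p, countIn S θ = countIn S' θ) →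
      MarkEquiv δ (Function.update M p S) (Function.update M p S') := by
    intro δ hδ q
    by_cases e : q = p
    · subst e; simpa using hδ
    · simp [e]
  exact ⟨hmk S hS, hmk S' hS', h.imp (heq δ₁) (heq δ₂)⟩

/-- Place-wise chains of equivalent contents combine to a chain of markings. -/
theorem CPN.reflTransGen_markStep [Fintype P] {N : CPN P T C B} {δ₁ δ₂ : P → Set (Set C)}
    {M M' : P → Multiset C} (hM : N.IsMk M) (hM' : N.IsMk M')
    (h : ∀ p, Relation.ReflTransGen (placeStep (N.dom p) (δ₁ p) (δ₂ p)) (M p) (M' p)) :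
    Relation.ReflTransGen (N.MarkStep δ₁ δ₂) M M' := by
  have key : ∀ s : Finset P, Relation.ReflTransGen (N.MarkStep δ₁ δ₂) M
      (fun q => if q ∈ s then M' q else M q) := by
    intro s
    induction s using Finset.induction_on with
    | empty => simpa using .refl
    | insert p s hp ih =>
      set K : P → Multiset C := fun q => if q ∈ s then M' q else M q with hK
      have hKmk : N.IsMk K := by
        intro q
        by_cases hq : q ∈ s
        · simpa [hK, hq] using hM' q
        · simpa [hK, hq] using hM q
      have hstep := (h p).lift (Function.update K p) fun _ _ => CPN.MarkStep.update hKmk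
      have hleft : Function.update K p (M p) = K := by
        rw [Function.update_eq_self_iff]
        simp [hK, hp]
      have hright : Function.update K p (M' p) =
          fun q => if q ∈ insert p s then M' q else M q := by
        funext q
        by_cases e : q = p
        · subst e; simp
        · simp [e, hK]
      rw [Function.onFun_apply, hleft, hright] at hstep
      exact ih.trans hstep
  simpa using key Finset.univ

theorem CPN.IsPartition.reflTransGen_markStep [Fintype P] {N : CPN P T C B}
    {δ₁ δ₂ : P → Set (Set C)} (h₁ : N.IsPartition δ₁) (h₂ : N.IsPartition δ₂)
    {M M' : P → Multiset C} (hM : N.IsMk M) (hM' : N.IsMk M')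
    (h : MarkEquiv (_root_.partUnion δ₁ δ₂) M M') :
    Relation.ReflTransGen (N.MarkStep δ₁ δ₂) M M' := by
  refine CPN.reflTransGen_markStep hM hM' fun p => ?_
  refine reflTransGen_placeStep_of_rel ?_ (h₁ p).2.2 (h₂ p).2.2 ?_ (hM p) (hM' p)
  · rw [Set.sUnion_union, (h₁ p).2.1, (h₂ p).2.1, Set.union_self]
  · refine ((h₁.partUnion h₂).rel_sameClass hM hM' h p).mono ?_
    rintro a _ b _ ⟨_, ⟨θ, _, rfl⟩, ha, hb⟩
    exact reflTransGen_sameClass_of_mem_classUnion ha hb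

/-- If `δ₁` and `δ₂` are stable partitions of a CPN `N`, then the partition
union `δ₁ ⊔ δ₂` is also a stable partition of `N`. -/
theorem partUnion_stable [Fintype P] [Fintype T] (N : CPN P T C B) (hWF : N.WF)
    (δ₁ δ₂ : P → Set (Set C)) (h₁ : N.IsPartition δ₁) (hs₁ : N.IsStable δ₁)
    (h₂ : N.IsPartition δ₂) (hs₂ : N.IsStable δ₂) :
    N.IsPartition (partUnion δ₁ δ₂) ∧ N.IsStable (partUnion δ₁ δ₂) := by
  refine ⟨h₁.partUnion h₂, fun M₁ M₂ hM₁ hM₂ he t M₁' hf => ?_⟩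
  have hchain := h₁.reflTransGen_markStep h₂ hM₁ hM₂ he
  clear he hM₂
  induction hchain with
  | refl => exact ⟨M₁', hf, fun _ _ _ => rfl⟩
  | tail _ hstep ih =>
    obtain ⟨K', hK', he⟩ := ih
    obtain ⟨hK, hL, h⟩ := hstep
    rcases h with h | h
    · obtain ⟨L', hL', he'⟩ := hs₁ _ _ hK hL h t K' hK'
      have := h₁.markEquiv_partUnion (δ₂ := δ₂) (fun p => Set.subset_union_left)
        (hK.of_fires hWF hK') (hL.of_fires hWF hL') he'
      exact ⟨L', hL', fun p θ hθ => (he p θ hθ).trans (this p θ hθ)⟩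
    · obtain ⟨L', hL', he'⟩ := hs₂ _ _ hK hL h t K' hK'
      have := h₂.markEquiv_partUnion (δ₁ := δ₁) (fun p => Set.subset_union_right)
        (hK.of_fires hWF hK') (hL.of_fires hWF hL') he'
      exact ⟨L', hL', fun p θ hθ => (he p θ hθ).trans (this p θ hθ)⟩

end
end

section
/- Let N be a CPN with initial marking M₀, let α₀ be the initial color approximation defined by α₀(p)=set(M₀(p)) for all p∈P, and let α be a fixed point of the color expansion E with α₀(p) ⊆ α(p) for all p∈P. Then every marking M reachable from M₀ (i.e., M₀ →* M, where →* is the reflexive-transitive closure of the union of the firing relations →t over t∈T) satisfies M ⊆ α, that is, set(M(p)) ⊆ α(p) for all p∈P. -/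
/- Formalization of colored Petri nets (CPN) following the paper's definitions. -/

noncomputable section
attribute [local instance] Classical.propDecidable
attribute [local instance] Classical.decEq

variable {P T C B : Type}

/-- A color approximation: `α(p) ⊆ C(p)` for all places `p`. -/
def CPN.IsApprox (N : CPN P T C B) (α : P → Set C) : Prop := ∀ p, α p ⊆ N.dom p

/-- The color expansion `E`:
`E(α)(p) = α(p) ∪ ⋃ {set(W((t,p),b)) : t ∈ T, b ∈ B(t), set(W((q,t),b)) ⊆ α(q) for all q}`. -/
def CPN.expand (N : CPN P T C B) (α : P → Set C) : P → Set C := fun p =>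
  α p ∪ {c | ∃ t b, N.guard t b ∧ (∀ q, ∀ c' ∈ N.pre q t b, c' ∈ α q) ∧ c ∈ N.post t p b}

/-- Reachability `→*`: the reflexive-transitive closure of the union of the firing
relations `→t` over `t ∈ T`. -/
def CPN.Reach (N : CPN P T C B) : (P → Multiset C) → (P → Multiset C) → Prop :=
  Relation.ReflTransGen fun M M' => ∃ t, N.Fires M t M'

/-- Firing a transition from a marking below `α` leads to a marking below `expand α`. -/
theorem CPN.Fires.mem_expand {N : CPN P T C B} {M M' : P → Multiset C} {t : T}
    {α : P → Set C} (h : N.Fires M t M') (hM : ∀ p, ∀ c ∈ M p, c ∈ α p) :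
    ∀ p, ∀ c ∈ M' p, c ∈ N.expand α p := by
  obtain ⟨b, hguard, hpre, -, hM'⟩ := h
  intro p c hc
  rw [hM' p, Multiset.mem_add] at hc
  rcases hc with hc | hc
  · exact Or.inl (hM p c (Multiset.mem_of_le (Multiset.sub_le_self _ _) hc))
  · exact Or.inr ⟨t, b, hguard, fun q c' hc' => hM q c' (Multiset.mem_of_le (hpre q) hc'), hc⟩

/-- If `α` is a fixed point of the color expansion `E` with
`α₀(p) = set(M₀(p)) ⊆ α(p)` for all `p`, then every marking `M` reachable from `M₀`
satisfies `M ⊆ α`, i.e. `set(M(p)) ⊆ α(p)` for all `p`. -/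
theorem reachable_subset_fixed_point [Fintype P] [Fintype T] (N : CPN P T C B) (hWF : N.WF)
    (α : P → Set C) (hα : N.IsApprox α) (hfix : N.expand α = α)
    (h0 : ∀ p, ∀ c ∈ N.M0 p, c ∈ α p) :
    ∀ M, N.Reach N.M0 M → ∀ p, ∀ c ∈ M p, c ∈ α p := by
  intro M hM
  induction hM with
  | refl => exact h0
  | tail _ hstep ih =>
    obtain ⟨t, ht⟩ := hstep
    exact hfix ▸ ht.mem_expand ih

end
end

section
/- Let N be a CPN with initial marking M₀, let α be a fixed point of the color expansion E satisfying set(M₀(p)) ⊆ α(p) for all p∈P, and let N^α be the reduced CPN obtained from N by replacing the color domain function with C^α(p)=α(p) (all other components unchanged). Then the reachable fragments from M₀ of the labeled transition systems generated by N and by N^α are isomorphic: every marking reachable from M₀ in N is a marking of N^α, M₀ is a marking of N^α, and the firing relations of N and N^α coincide on markings reachable from M₀. -/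
/- Formalization of colored Petri nets (CPN) following the paper's definitions. -/

noncomputable section
attribute [local instance] Classical.propDecidable
attribute [local instance] Classical.decEq

variable {P T C B : Type}

/-- The reduced CPN `N^α`: same as `N` but with color domain function `C^α(p) = α(p)`. -/
def CPN.restrictDom (N : CPN P T C B) (α : P → Set C) : CPN P T C B := { N with dom := α }

/-- Firing a transition preserves the property that all colors lie in a fixed point of the
color expansion. -/
theorem CPN.Fires.isMk_restrictDom {N : CPN P T C B} {α : P → Set C} (hfix : N.expand α = α)
    {M M' : P → Multiset C} {t : T} (h : N.Fires M t M') (hM : (N.restrictDom α).IsMk M) :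
    (N.restrictDom α).IsMk M' := by
  obtain ⟨b, hguard, hpre, -, hM'⟩ := h
  intro p c hc
  rw [hM' p, Multiset.mem_add] at hc
  rcases hc with hc | hc
  · exact hM p c (Multiset.mem_of_le (Multiset.sub_le_self _ _) hc)
  · have hmem : c ∈ N.expand α p :=
      Or.inr ⟨t, b, hguard, fun q c' hc' => hM q c' (Multiset.mem_of_le (hpre q) hc'), hc⟩
    rwa [hfix] at hmem

/-- Every marking reachable from a marking with colors in a fixed point of the color expansion
has its colors in that fixed point. -/
theorem CPN.Reach.isMk_restrictDom {N : CPN P T C B} {α : P → Set C} (hfix : N.expand α = α)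
    {M M' : P → Multiset C} (h : N.Reach M M') (hM : (N.restrictDom α).IsMk M) :
    (N.restrictDom α).IsMk M' := by
  induction h with
  | refl => exact hM
  | tail _ hstep ih =>
    obtain ⟨t, ht⟩ := hstep
    exact ht.isMk_restrictDom hfix ih

/-- For a fixed point `α` of `E` with `set(M₀(p)) ⊆ α(p)` for all `p`, the
reachable fragments from `M₀` of the LTSs generated by `N` and by the reduced net `N^α` are
isomorphic: every marking reachable from `M₀` in `N` is a marking of `N^α`, `M₀` is a marking
of `N^α`, and the firing relations of `N` and `N^α` coincide on markings reachable
from `M₀`. -/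
theorem reduced_net_reachable_fragment_iso [Fintype P] [Fintype T] (N : CPN P T C B)
    (hWF : N.WF) (α : P → Set C) (hα : N.IsApprox α) (hfix : N.expand α = α)
    (h0 : ∀ p, ∀ c ∈ N.M0 p, c ∈ α p) :
    (N.restrictDom α).IsMk N.M0 ∧
    (∀ M, N.Reach N.M0 M → (N.restrictDom α).IsMk M) ∧
    (∀ M, N.Reach N.M0 M → ∀ t M',
      (N.Fires M t M' ↔ (N.restrictDom α).Fires M t M')) := by
  exact ⟨h0, fun _ hM => hM.isMk_restrictDom hfix h0, fun _ _ _ _ => Iff.rfl⟩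

end
end
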